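/- Let 𝒜 be an infinite Boolean algebra with the weak subsequential separation property and K_𝒜 its Stone space. Then the Banach space ℓ∞ (of bounded real sequences with the supremum norm) is a quotient of C(K_𝒜): there exists a continuous linear surjection from C(K_𝒜, ℝ) onto ℓ∞. -/

import Mathlib

open scoped ENNReal

/-- A Boolean algebra has the *weak subsequential separation property* if for every
injective sequence of pairwise disjoint nonzero elements `(Aₙ)` there is an `a` such that
both `{n | Aₙ ≤ a}` and `{n | Aₙ ⊓ a = ⊥}` are infinite. -/
def WeakSubseqSep (A : Type*) [BooleanAlgebra A] : Prop :=
  ∀ f : ℕ → A, Function.Injective f → (∀ n, f n ≠ ⊥) →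
    (∀ m n, m ≠ n → f m ⊓ f n = ⊥) →
    ∃ a : A, {n : ℕ | f n ≤ a}.Infinite ∧ {n : ℕ | f n ⊓ a = ⊥}.Infinite


/-- A map `A → Bool` that is a Boolean homomorphism (an "ultrafilter" on `A`). -/
def IsBoolHom {A : Type*} [BooleanAlgebra A] (x : A → Bool) : Prop :=
  x ⊤ = true ∧ x ⊥ = false ∧ (∀ a b, x (a ⊓ b) = (x a && x b)) ∧
    (∀ a b, x (a ⊔ b) = (x a || x b))

/-- The Stone space of a Boolean algebra: the space of Boolean homomorphisms `A → Bool`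
(equivalently, ultrafilters on `A`), with the topology induced from the product topology
on `A → Bool` (`Bool` discrete); this is the topology generated by the sets
`[a] = {x | x a = true}` for `a : A`. -/
def StoneSpace (A : Type*) [BooleanAlgebra A] : Type _ :=
  {x : A → Bool // IsBoolHom x}

instance (A : Type*) [BooleanAlgebra A] : TopologicalSpace (StoneSpace A) :=
  inferInstanceAs (TopologicalSpace {x : A → Bool // IsBoolHom x})

instance (A : Type*) [BooleanAlgebra A] : T2Space (StoneSpace A) :=
  inferInstanceAs (T2Space {x : A → Bool // IsBoolHom x})

private lemma isBoolHom_closed (A : Type*) [BooleanAlgebra A] :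
    IsClosed {x : A → Bool | IsBoolHom x} := by
  have hand : Continuous fun p : Bool × Bool => p.1 && p.2 := continuous_of_discreteTopology
  have hor : Continuous fun p : Bool × Bool => p.1 || p.2 := continuous_of_discreteTopology
  have h1 : IsClosed {x : A → Bool | x ⊤ = true} :=
    isClosed_eq (continuous_apply (⊤ : A)) continuous_const
  have h2 : IsClosed {x : A → Bool | x ⊥ = false} :=
    isClosed_eq (continuous_apply (⊥ : A)) continuous_const
  have h3 : IsClosed {x : A → Bool | ∀ a b, x (a ⊓ b) = (x a && x b)} := by
    have e : {x : A → Bool | ∀ a b, x (a ⊓ b) = (x a && x b)} =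
        ⋂ (a : A) (b : A), {x : A → Bool | x (a ⊓ b) = (x a && x b)} := by
      ext x; simp
    rw [e]
    exact isClosed_iInter fun a => isClosed_iInter fun b =>
      isClosed_eq (continuous_apply _)
        (hand.comp₂ (continuous_apply a) (continuous_apply b))
  have h4 : IsClosed {x : A → Bool | ∀ a b, x (a ⊔ b) = (x a || x b)} := by
    have e : {x : A → Bool | ∀ a b, x (a ⊔ b) = (x a || x b)} =
        ⋂ (a : A) (b : A), {x : A → Bool | x (a ⊔ b) = (x a || x b)} := by
      ext x; simp
    rw [e]
    exact isClosed_iInter fun a => isClosed_iInter fun b =>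
      isClosed_eq (continuous_apply _)
        (hor.comp₂ (continuous_apply a) (continuous_apply b))
  have e : {x : A → Bool | IsBoolHom x} =
      ({x : A → Bool | x ⊤ = true} ∩ {x : A → Bool | x ⊥ = false}) ∩
        ({x : A → Bool | ∀ a b, x (a ⊓ b) = (x a && x b)} ∩
          {x : A → Bool | ∀ a b, x (a ⊔ b) = (x a || x b)}) := by
    ext x; simp [IsBoolHom, and_assoc]
  rw [e]
  exact ((h1.inter h2).inter (h3.inter h4))

instance (A : Type*) [BooleanAlgebra A] : CompactSpace (StoneSpace A) :=
  isCompact_iff_compactSpace.mp ((isBoolHom_closed A).isCompact)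

/-! ### Auxiliary material -/

section Aux

variable {A : Type*} [BooleanAlgebra A]

/-- An element is big if it has an infinite disjoint family of nonzero elements below it. -/
def IsBig (a : A) : Prop :=
  ∃ f : ℕ → A, (∀ n, f n ≠ ⊥) ∧ (∀ m n, m ≠ n → f m ⊓ f n = ⊥) ∧ ∀ n, f n ≤ a

lemma IsBig.ne_bot {a : A} (h : IsBig a) : a ≠ ⊥ := by
  obtain ⟨f, h1, -, h3⟩ := h
  rintro rfl
  exact h1 0 (le_bot_iff.1 (h3 0))

lemma injective_of_disj {f : ℕ → A} (h1 : ∀ n, f n ≠ ⊥)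
    (h2 : ∀ m n, m ≠ n → f m ⊓ f n = ⊥) : Function.Injective f := by
  intro m n hmn
  by_contra hne
  have := h2 m n hne
  rw [hmn, inf_idem] at this
  exact h1 n this

lemma isBig_of_infinite_set {f : ℕ → A} (h1 : ∀ n, f n ≠ ⊥)
    (h2 : ∀ m n, m ≠ n → f m ⊓ f n = ⊥) {a : A} {s : Set ℕ} (hs : s.Infinite)
    (h3 : ∀ n ∈ s, f n ≤ a) : IsBig a := by
  let e := hs.natEmbedding
  refine ⟨fun n => f (e n), fun n => h1 _, fun m n hmn => h2 _ _ ?_, fun n => h3 _ (e n).2⟩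
  intro he
  exact hmn (e.injective (Subtype.ext he))

lemma IsBig.split (h : WeakSubseqSep A) {a : A} (ha : IsBig a) :
    ∃ b ≤ a, IsBig b ∧ IsBig (a \ b) := by
  obtain ⟨f, h1, h2, h3⟩ := ha
  obtain ⟨c, hc1, hc2⟩ := h f (injective_of_disj h1 h2) h1 h2
  refine ⟨a ⊓ c, inf_le_left, isBig_of_infinite_set h1 h2 hc1 fun n hn => le_inf (h3 n) hn,
    isBig_of_infinite_set h1 h2 hc2 fun n hn => ?_⟩
  rw [sdiff_inf_self_left]
  exact le_sdiff.2 ⟨h3 n, disjoint_iff.2 hn⟩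

lemma infinite_step (a : A) (ha : (Set.Iic a).Infinite) :
    ∃ b < a, (Set.Iic b).Infinite := by
  have hex : ∃ b ∈ Set.Iic a, b ∉ ({⊥, a} : Set A) :=
    ha.exists_notMem_finite (Set.toFinite _)
  obtain ⟨b, hb, hb'⟩ := hex
  simp only [Set.mem_insert_iff, Set.mem_singleton_iff, not_or] at hb'
  have hba : b ≤ a := hb
  by_cases hfin : (Set.Iic b).Infinite
  · exact ⟨b, lt_of_le_of_ne hba hb'.2, hfin⟩
  · refine ⟨a \ b, sdiff_lt hba hb'.1, fun hfin2 => ha ?_⟩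
    have hfin := Set.not_infinite.1 hfin
    refine ((hfin.prod hfin2).image fun p : A × A => p.1 ⊔ p.2).subset ?_
    intro c hc
    refine ⟨(c ⊓ b, c \ b), ⟨inf_le_right, sdiff_le_sdiff_right hc⟩, ?_⟩
    exact sup_inf_sdiff c b

lemma isBig_top [Infinite A] : IsBig (⊤ : A) := by
  have step : ∀ a : {a : A // (Set.Iic a).Infinite}, ∃ b : {a : A // (Set.Iic a).Infinite},
      b.1 < a.1 := fun a => by
    obtain ⟨b, hb, hb'⟩ := infinite_step a.1 a.2
    exact ⟨⟨b, hb'⟩, hb⟩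
  choose g hg using step
  let top : {a : A // (Set.Iic a).Infinite} := ⟨⊤, by rw [Set.Iic_top]; exact Set.infinite_univ⟩
  let u : ℕ → A := fun n => (g^[n] top).1
  have hu : ∀ n, u (n + 1) < u n := fun n => by
    simp only [u, Function.iterate_succ_apply']
    exact hg _
  have hanti : StrictAnti u := strictAnti_nat_of_succ_lt hu
  have hlt : ∀ m n, m < n → (u m \ u (m + 1)) ⊓ (u n \ u (n + 1)) = ⊥ := by
    intro m n hmn
    have h1 : u n ≤ u (m + 1) := hanti.antitone hmn
    exact disjoint_iff.1 (disjoint_sdiff_self_left.mono_right (sdiff_le.trans h1))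
  refine ⟨fun n => u n \ u (n + 1), fun n hn => ?_, fun m n hmn => ?_, fun n => le_top⟩
  · exact absurd (sdiff_eq_bot_iff.1 hn) (not_le_of_gt (hu n))
  · rcases lt_or_gt_of_ne hmn with hlt' | hlt'
    · exact hlt m n hlt'
    · rw [inf_comm]; exact hlt n m hlt'

/-- Literal. -/
def lit (a : A) (b : Bool) : A := if b then a else aᶜ

/-- Finite intersections of literals. -/
def atm (V : ℕ → A) (s : ℕ → Bool) : ℕ → A
  | 0 => ⊤
  | n + 1 => atm V s n ⊓ lit (V n) (s n)

lemma atm_le (V : ℕ → A) (s : ℕ → Bool) {i N : ℕ} (h : i < N) :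
    atm V s N ≤ lit (V i) (s i) := by
  induction N with
  | zero => omega
  | succ n ih =>
    rcases Nat.lt_succ_iff_lt_or_eq.1 h with h' | rfl
    · exact inf_le_left.trans (ih h')
    · exact inf_le_right

open Classical in
/-- The successive partitions. -/
noncomputable def parts (σ : A → A) : ℕ → Finset A
  | 0 => {⊤}
  | n + 1 => (parts σ n).image σ ∪ (parts σ n).image (fun a => a \ σ a)

lemma exists_indep [Infinite A] (h : WeakSubseqSep A) :
    ∃ V : ℕ → A, ∀ s N, atm V s N ≠ ⊥ := by
  classical
  have hs : ∀ a : A, ∃ b ≤ a, IsBig a → IsBig b ∧ IsBig (a \ b) := fun a => by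
    by_cases ha : IsBig a
    · obtain ⟨b, hb, hb'⟩ := ha.split h
      exact ⟨b, hb, fun _ => hb'⟩
    · exact ⟨a, le_rfl, fun h => absurd h ha⟩
  choose σ hσ hbig using hs
  have hpb : ∀ n, ∀ a ∈ parts σ n, IsBig a := by
    intro n
    induction n with
    | zero => simp [parts, isBig_top]
    | succ n ih =>
      intro a ha
      simp only [parts, Finset.mem_union, Finset.mem_image] at ha
      rcases ha with ⟨b, hb, rfl⟩ | ⟨b, hb, rfl⟩
      · exact (hbig b (ih b hb)).1
      · exact (hbig b (ih b hb)).2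
  have hpd : ∀ n, ∀ a ∈ parts σ n, ∀ b ∈ parts σ n, a ≠ b → Disjoint a b := by
    intro n
    induction n with
    | zero => simp [parts]
    | succ n ih =>
      intro a ha b hb hab
      simp only [parts, Finset.mem_union, Finset.mem_image] at ha hb
      rcases ha with ⟨a, ha, rfl⟩ | ⟨a, ha, rfl⟩ <;> rcases hb with ⟨b, hb, rfl⟩ | ⟨b, hb, rfl⟩
      · by_cases e : a = b
        · exact absurd (by rw [e]) hab
        · exact (ih a ha b hb e).mono (hσ _) (hσ _)
      · by_cases e : a = b
        · subst e; exact disjoint_sdiff_self_right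
        · exact (ih a ha b hb e).mono (hσ _) sdiff_le
      · by_cases e : a = b
        · subst e; exact disjoint_sdiff_self_left
        · exact (ih a ha b hb e).mono sdiff_le (hσ _)
      · by_cases e : a = b
        · exact absurd (by rw [e]) hab
        · exact (ih a ha b hb e).mono sdiff_le sdiff_le
  let V : ℕ → A := fun n => (parts σ n).sup σ
  have hV : ∀ n, ∀ a ∈ parts σ n, a ⊓ V n = σ a := by
    intro n a ha
    apply le_antisymm
    · simp only [V]
      rw [Finset.sup_inf_distrib_left]
      apply Finset.sup_le
      intro b hb
      by_cases e : a = b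
      · subst e; exact inf_le_right
      · have := (hpd n a ha b hb e).mono_right (hσ b)
        rw [disjoint_iff.1 this]
        exact bot_le
    · exact le_inf (hσ a) (Finset.le_sup (f := σ) ha)
  refine ⟨V, fun s N => ?_⟩
  have hmem : ∀ n, atm V s n ∈ parts σ n := by
    intro n
    induction n with
    | zero => simp [atm, parts]
    | succ n ih =>
      simp only [parts, Finset.mem_union, Finset.mem_image, atm, lit]
      cases s n
      · right
        refine ⟨_, ih, ?_⟩
        rw [← hV n _ ih, sdiff_inf_self_left, sdiff_eq]
        simp
      · left
        refine ⟨_, ih, ?_⟩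
        rw [← hV n _ ih]
        simp
  exact (hpb N _ (hmem N)).ne_bot

open Classical in
/-- Almost disjoint family of infinite sets (as injective sequences). -/
noncomputable def adIdx (S : Set ℕ) (n : ℕ) : ℕ :=
  Nat.pair n (Encodable.encode ((Finset.range n).filter (· ∈ S)))

lemma adIdx_inj {S T : Set ℕ} {m n : ℕ} (h : adIdx S m = adIdx T n) :
    m = n ∧ ∀ k < m, k ∈ S ↔ k ∈ T := by
  unfold adIdx at h
  rw [Nat.pair_eq_pair] at h
  obtain ⟨rfl, h2⟩ := h
  refine ⟨rfl, fun k hk => ?_⟩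
  have h3 := Encodable.encode_injective h2
  have := Finset.ext_iff.1 h3 k
  simpa [hk] using this

lemma adIdx_ad {S T : Set ℕ} (h : S ≠ T) : ∃ k, ∀ n > k, ∀ m, adIdx S n ≠ adIdx T m := by
  by_contra! hc
  apply h
  ext k
  obtain ⟨n, hn, m, hm⟩ := hc k
  exact (adIdx_inj hm).2 k hn

lemma exists_big_indep [Infinite A] (h : WeakSubseqSep A) :
    ∃ W : Set ℕ → A, ∀ (F : Finset (Set ℕ)) (ε : Set ℕ → Bool),
      ∃ a : A, a ≠ ⊥ ∧ ∀ S ∈ F, a ≤ lit (W S) (ε S) := by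
  classical
  obtain ⟨V, hV⟩ := exists_indep h
  let d : Set ℕ → ℕ → A := fun S => disjointed fun n => V (adIdx S n)
  -- key fact
  have key : ∀ (F : Finset (Set ℕ)) (ν : Set ℕ → ℕ),
      (∀ S ∈ F, ∀ T ∈ F, S ≠ T → ∀ m, adIdx S (ν S) ≠ adIdx T m) →
      ∃ a : A, a ≠ ⊥ ∧ ∀ S ∈ F, a ≤ d S (ν S) := by
    intro F ν hν
    let s : ℕ → Bool := fun i => decide (∃ S ∈ F, adIdx S (ν S) = i)
    obtain ⟨N, hN⟩ : ∃ N, ∀ S ∈ F, ∀ j ≤ ν S, adIdx S j < N := by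
      refine ⟨(F.sup fun S => (Finset.range (ν S + 1)).sup (adIdx S)) + 1, ?_⟩
      intro S hS j hj
      rw [Nat.lt_succ_iff]
      exact (Finset.le_sup (f := adIdx S) (Finset.mem_range.2 (Nat.lt_succ_of_le hj))).trans
        (Finset.le_sup (f := fun S => (Finset.range (ν S + 1)).sup (adIdx S)) hS)
    refine ⟨atm V s N, hV s N, fun S hS => ?_⟩
    simp only [d, disjointed_apply]
    refine le_sdiff.2 ⟨?_, ?_⟩
    · have h1 := atm_le V s (hN S hS _ le_rfl)
      have h2 : s (adIdx S (ν S)) = true := by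
        simp only [s, decide_eq_true_eq]; exact ⟨S, hS, rfl⟩
      simpa [h2, lit] using h1
    · rw [Finset.disjoint_sup_right]
      intro j hj
      rw [Finset.mem_Iio] at hj
      have h1 := atm_le V s (hN S hS j hj.le)
      have h2 : s (adIdx S j) = false := by
        simp only [s, decide_eq_false_iff_not]
        rintro ⟨T, hT, hTS⟩
        by_cases e : T = S
        · subst e
          exact hj.ne' (adIdx_inj hTS).1
        · exact hν T hT S hS e j hTS
      rw [h2] at h1
      exact le_compl_iff_disjoint_right.1 (by simpa [lit] using h1)
  have hd1 : ∀ S n, d S n ≠ ⊥ := by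
    intro S n hn
    obtain ⟨a, ha, ha'⟩ := key {S} (fun _ => n) (by
      intro S hS T hT hST
      simp only [Finset.mem_singleton] at hS hT
      exact absurd (hS.trans hT.symm) hST)
    have := ha' S (Finset.mem_singleton_self S)
    rw [hn] at this
    exact ha (le_bot_iff.1 this)
  have hd2 : ∀ S m n, m ≠ n → d S m ⊓ d S n = ⊥ := fun S m n hmn =>
    disjoint_iff.1 (disjoint_disjointed (fun n => V (adIdx S n)) hmn)
  have hW : ∀ S, ∃ a : A, {n : ℕ | d S n ≤ a}.Infinite ∧ {n : ℕ | d S n ⊓ a = ⊥}.Infinite :=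
    fun S => h (d S) (injective_of_disj (hd1 S) (hd2 S)) (hd1 S) (hd2 S)
  choose W hW1 hW2 using hW
  refine ⟨W, fun F ε => ?_⟩
  have hinf : ∀ S, {n : ℕ | d S n ≤ lit (W S) (ε S)}.Infinite := by
    intro S
    cases hε : ε S
    · refine (hW2 S).mono fun n hn => ?_
      simp only [lit, Set.mem_ofPred_eq]
      exact le_compl_iff_disjoint_right.2 (disjoint_iff.2 hn)
    · simpa [lit] using hW1 S
  have hk : ∀ S T : Set ℕ, ∃ k, S ≠ T → ∀ n > k, ∀ m, adIdx S n ≠ adIdx T m := fun S T => by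
    by_cases e : S = T
    · exact ⟨0, fun h => absurd e h⟩
    · obtain ⟨k, hk⟩ := adIdx_ad e
      exact ⟨k, fun _ => hk⟩
  choose k hk using hk
  have hν : ∀ S, ∃ n, d S n ≤ lit (W S) (ε S) ∧ F.sup (k S) < n := fun S => by
    obtain ⟨n, hn, hn'⟩ := (hinf S).exists_gt (F.sup (k S))
    exact ⟨n, hn, hn'⟩
  choose ν hν1 hν2 using hν
  obtain ⟨a, ha, ha'⟩ := key F ν (fun S _ T hT hST m =>
    hk S T hST _ ((Finset.le_sup (f := k S) hT).trans_lt (hν2 S)) m)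
  exact ⟨a, ha, fun S hS => (ha' S hS).trans (hν1 S)⟩

lemma exists_point {a : A} (ha : a ≠ ⊥) : ∃ x : StoneSpace A, x.1 a = true := by
  classical
  have hdis : Disjoint ((Order.PFilter.principal a : Order.PFilter A) : Set A)
      ((Order.Ideal.principal (⊥ : A) : Order.Ideal A) : Set A) := by
    rw [Set.disjoint_left]
    intro b hb hb'
    have h1 : a ≤ b := hb
    have h2 : b ≤ ⊥ := hb'
    exact ha (le_bot_iff.1 (h1.trans h2))
  obtain ⟨J, hJ, -, hd⟩ := DistribLattice.prime_ideal_of_disjoint_filter_ideal hdis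
  have haJ : a ∉ J := fun h => Set.disjoint_left.1 hd (show a ≤ a from le_rfl) h
  refine ⟨⟨fun b => decide (b ∉ J), ?_, ?_, ?_, ?_⟩, ?_⟩
  · simp only [decide_eq_true_eq]
    exact fun h => haJ (J.lower le_top h)
  · simp
  · intro b c
    have : b ⊓ c ∈ J ↔ b ∈ J ∨ c ∈ J :=
      ⟨hJ.mem_or_mem, fun h => h.elim (J.lower inf_le_left) (J.lower inf_le_right)⟩
    simp [this]
  · intro b c
    have : b ⊔ c ∈ J ↔ b ∈ J ∧ c ∈ J := Order.Ideal.sup_mem_iff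
    simp [this, imp_iff_not_or]
  · simpa using haJ

lemma point_compl (x : StoneSpace A) (a : A) : x.1 aᶜ = !x.1 a := by
  obtain ⟨x, h1, h2, h3, h4⟩ := x
  have e1 := h3 a aᶜ
  have e2 := h4 a aᶜ
  rw [inf_compl_eq_bot, h2] at e1
  rw [sup_compl_eq_top, h1] at e2
  show x aᶜ = !x a
  revert e1 e2
  generalize x a = p
  generalize x aᶜ = q
  revert p q
  decide

lemma point_mono (x : StoneSpace A) {a b : A} (h : a ≤ b) (ha : x.1 a = true) :
    x.1 b = true := by
  have := x.2.2.2.1 a b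
  rw [inf_eq_left.2 h, ha] at this
  simpa using this.symm

lemma continuous_eval (a : A) : Continuous fun x : StoneSpace A => x.1 a :=
  (continuous_apply a).comp continuous_subtype_val

lemma exists_points [Infinite A] (h : WeakSubseqSep A) :
    ∃ (W : Set ℕ → A) (x : ℕ → StoneSpace A), ∀ S n, (x n).1 (W S) = true ↔ n ∈ S := by
  classical
  obtain ⟨W, hW⟩ := exists_big_indep h
  have : ∀ ε : Set ℕ → Bool, ∃ x : StoneSpace A, ∀ S, x.1 (W S) = ε S := by
    intro ε
    have := CompactSpace.iInter_nonempty
      (t := fun S : Set ℕ => {x : StoneSpace A | x.1 (W S) = ε S})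
      (fun S => isClosed_eq (continuous_eval (W S)) continuous_const) (by
        intro F
        obtain ⟨a, ha, haF⟩ := hW F ε
        obtain ⟨x, hx⟩ := exists_point ha
        refine ⟨x, ?_⟩
        simp only [Set.mem_iInter, Set.mem_ofPred_eq]
        intro S hS
        have := point_mono x (haF S hS) hx
        cases hε : ε S
        · rw [hε] at this
          simpa [lit, point_compl] using this
        · rw [hε] at this
          simpa [lit] using this)
    obtain ⟨x, hx⟩ := this
    exact ⟨x, fun S => Set.mem_iInter.1 hx S⟩
  choose p hp using this
  refine ⟨W, fun n => p fun S => decide (n ∈ S), fun S n => ?_⟩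
  rw [hp]
  simp

/-- Evaluation along a sequence. -/
noncomputable def evalSeq {K : Type*} [TopologicalSpace K] [CompactSpace K] (x : ℕ → K) :
    C(K, ℝ) →L[ℝ] lp (fun _ : ℕ => ℝ) ∞ :=
  LinearMap.mkContinuous
    { toFun := fun f => ⟨fun n => f (x n), memℓp_infty ⟨‖f‖, by
        rintro _ ⟨n, rfl⟩
        exact f.norm_coe_le_norm (x n)⟩⟩
      map_add' := fun f g => by ext n; rfl
      map_smul' := fun c f => by ext n; rfl } 1 (fun f => by
        rw [one_mul]
        refine lp.norm_le_of_forall_le (norm_nonneg f) fun n => ?_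
        exact f.norm_coe_le_norm (x n))

lemma evalSeq_apply {K : Type*} [TopologicalSpace K] [CompactSpace K] (x : ℕ → K)
    (f : C(K, ℝ)) (n : ℕ) : evalSeq x f n = f (x n) := rfl

lemma step_approx {W : Set ℕ → A} {x : ℕ → StoneSpace A}
    (hx : ∀ S n, (x n).1 (W S) = true ↔ n ∈ S) (g : lp (fun _ : ℕ => ℝ) ∞) :
    ∃ f : C(StoneSpace A, ℝ), ‖f‖ ≤ ‖g‖ / 2 ∧ ‖g - evalSeq x f‖ ≤ ‖g‖ / 2 := by
  classical
  let S : Set ℕ := {n | 0 ≤ g n}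
  let q : Bool → ℝ := fun b => if b then ‖g‖ / 2 else -(‖g‖ / 2)
  let f : C(StoneSpace A, ℝ) := ⟨fun y => q (y.1 (W S)),
    (continuous_of_discreteTopology (f := q)).comp (continuous_eval (W S))⟩
  have hg := norm_nonneg g
  refine ⟨f, ?_, ?_⟩
  · rw [ContinuousMap.norm_le _ (by positivity)]
    intro y
    show ‖q (y.1 (W S))‖ ≤ _
    cases y.1 (W S) <;> simp [q]
  · refine lp.norm_le_of_forall_le (by positivity) fun n => ?_
    have h1 : |g n| ≤ ‖g‖ := lp.norm_apply_le_norm ENNReal.top_ne_zero g n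
    rw [abs_le] at h1
    show |g n - q ((x n).1 (W S))| ≤ _
    by_cases hn : n ∈ S
    · have h2 : 0 ≤ g n := hn
      rw [(hx S n).2 hn, abs_le]
      simp only [q, if_true]
      constructor <;> linarith
    · have h2 : g n < 0 := not_le.1 hn
      have h3 : (x n).1 (W S) = false := by
        rw [← Bool.not_eq_true, hx]; exact hn
      rw [h3, abs_le]
      simp only [q, Bool.false_eq_true, if_false]
      constructor <;> linarith

lemma surj_of_approx {E F : Type*} [NormedAddCommGroup E] [NormedSpace ℝ E] [CompleteSpace E]
    [NormedAddCommGroup F] [NormedSpace ℝ F] (T : E →L[ℝ] F)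
    (h : ∀ g : F, ∃ f : E, ‖f‖ ≤ ‖g‖ / 2 ∧ ‖g - T f‖ ≤ ‖g‖ / 2) : Function.Surjective T := by
  choose r hr1 hr2 using h
  intro g
  let u : ℕ → F := fun n => (fun y => y - T (r y))^[n] g
  have hu : ∀ n, u (n + 1) = u n - T (r (u n)) := fun n => by
    simp only [u, Function.iterate_succ_apply']
  have hun : ∀ n, ‖u n‖ ≤ ‖g‖ * (1 / 2) ^ n := by
    intro n
    induction n with
    | zero => simp [u]
    | succ n ih =>
      rw [hu, pow_succ]
      have := hr2 (u n)
      linarith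
  have hgeo : Summable fun n : ℕ => ‖g‖ * (1 / 2 : ℝ) ^ n :=
    (summable_geometric_of_lt_one (by norm_num) (by norm_num)).mul_left _
  have hsum : Summable fun n => r (u n) := by
    refine Summable.of_norm_bounded hgeo fun n => ?_
    have := hr1 (u n)
    have := hun n
    have := norm_nonneg (u n)
    linarith
  have h1 := (T.hasSum hsum.hasSum).tendsto_sum_nat
  have h2 : ∀ n, ∑ i ∈ Finset.range n, T (r (u i)) = g - u n := by
    intro n
    induction n with
    | zero => simp [u]
    | succ n ih => rw [Finset.sum_range_succ, ih, hu]; abel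
  have h3 : Filter.Tendsto u Filter.atTop (nhds 0) :=
    squeeze_zero_norm hun hgeo.tendsto_atTop_zero
  have h4 : Filter.Tendsto (fun n => g - u n) Filter.atTop (nhds g) := by
    simpa using h3.const_sub g
  refine ⟨∑' n, r (u n), tendsto_nhds_unique h1 ?_⟩
  simpa only [h2] using h4

end Aux

/-- If an infinite Boolean algebra has the weak subsequential separation property, then
`ℓ∞` is a quotient of the Banach space `C(K_A, ℝ)` of continuous functions on the Stone
space: there is a continuous linear surjection from `C(K_A, ℝ)` onto `ℓ∞`. -/
theorem linfty_quotient_of_weakSubseqSep (A : Type*) [BooleanAlgebra A] [Infinite A]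
    (h : WeakSubseqSep A) :
    ∃ T : C(StoneSpace A, ℝ) →L[ℝ] lp (fun _ : ℕ => ℝ) ∞, Function.Surjective T := by
  obtain ⟨W, x, hx⟩ := exists_points h
  exact ⟨evalSeq x, surj_of_approx _ (step_approx hx)⟩
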